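/- For every 0 < a < b < 1 and every α > 0, the operator T(a, b, α) on ℓ²(ℤ,ℂ) ⊕ ℓ²(ℤ,ℂ) is irreducible: the only closed subspaces of ℓ²(ℤ,ℂ) ⊕ ℓ²(ℤ,ℂ) that are invariant under both T(a, b, α) and its adjoint are {0} and the whole space. -/

import Mathlib

noncomputable section

open ContinuousLinearMap

/-- The Hilbert space `ℓ²(ℤ, ℂ)`. -/
abbrev H : Type := lp (fun _ : ℤ => ℂ) 2

/-- The standard orthonormal basis vectors of `ℓ²(ℤ, ℂ)`. -/
def e (n : ℤ) : H := lp.single 2 n 1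

/-- The `2 × 2` upper-triangular block operator `[[T₁, S], [0, T₂]]` on the Hilbert space
direct sum `E ⊕ E = WithLp 2 (E × E)`. -/
def blockOp {E : Type*} [NormedAddCommGroup E] [NormedSpace ℂ E]
    (T₁ S T₂ : E →L[ℂ] E) : WithLp 2 (E × E) →L[ℂ] WithLp 2 (E × E) :=
  ((WithLp.prodContinuousLinearEquiv 2 ℂ E E).symm :
      E × E →L[ℂ] WithLp 2 (E × E)) ∘L
    ((((T₁ ∘L fst ℂ E E) + (S ∘L snd ℂ E E)).prod (T₂ ∘L snd ℂ E E)) ∘L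
      ((WithLp.prodContinuousLinearEquiv 2 ℂ E E) :
        WithLp 2 (E × E) →L[ℂ] E × E))

/-- Unitary equivalence of bounded operators on (possibly different) complex Hilbert spaces:
there is a unitary (= surjective linear isometry) `U` with `U A U⁻¹ = B`. -/
def UnitarilyEquiv {E F : Type*} [NormedAddCommGroup E] [NormedSpace ℂ E]
    [NormedAddCommGroup F] [NormedSpace ℂ F] (A : E →L[ℂ] E) (B : F →L[ℂ] F) : Prop :=
  ∃ U : E ≃ₗᵢ[ℂ] F, ∀ x, U (A x) = B (U x)

/-- The Möbius transform `e^{iθ} (T - c·1)(1 - c̄·T)⁻¹` of an operator. -/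
def mobius {E : Type*} [NormedAddCommGroup E] [NormedSpace ℂ E] [CompleteSpace E]
    (θ : ℝ) (c : ℂ) (T : E →L[ℂ] E) : E →L[ℂ] E :=
  Complex.exp (θ * Complex.I) •
    ((T - c • (1 : E →L[ℂ] E)) * Ring.inverse (1 - (starRingEnd ℂ c) • T))

/-- A bounded operator on a complex Hilbert space is homogeneous if its spectrum lies in the
closed unit disc and all its Möbius transforms are unitarily equivalent to it. -/
def Homogeneous {E : Type*} [NormedAddCommGroup E] [NormedSpace ℂ E] [CompleteSpace E]
    (T : E →L[ℂ] E) : Prop :=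
  spectrum ℂ T ⊆ Metric.closedBall 0 1 ∧
    ∀ (θ : ℝ) (c : ℂ), ‖c‖ < 1 →
      IsUnit (1 - (starRingEnd ℂ c) • T) ∧ UnitarilyEquiv (mobius θ c T) T

/-- A bounded operator is irreducible if the only closed subspaces invariant under both the
operator and its adjoint are `{0}` and the whole space. -/
def IrreducibleOp {E : Type*} [NormedAddCommGroup E] [InnerProductSpace ℂ E] [CompleteSpace E]
    (T : E →L[ℂ] E) : Prop :=
  ∀ M : Submodule ℂ E, IsClosed (M : Set E) → (∀ x ∈ M, T x ∈ M) →
    (∀ x ∈ M, ContinuousLinearMap.adjoint T x ∈ M) → M = ⊥ ∨ M = ⊤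

/-- Weight sequence of the shift `B_{λ, ia}`. -/
def wB (l a : ℝ) (n : ℤ) : ℂ :=
  ((n : ℂ) + (1 + (l : ℂ)) / 2 + Complex.I * (a : ℂ)) /
    ((n : ℂ) + (1 + (l : ℂ)) / 2 - Complex.I * (a : ℂ))

/-- Weight sequence of the shift `T(a, b)`. -/
def wT (a b : ℝ) (n : ℤ) : ℂ := (Real.sqrt (((n : ℝ) + a) / ((n : ℝ) + b)) : ℂ)

/-- Weight sequence of the shift `S[λ]`. -/
def wS (l : ℝ) (n : ℤ) : ℂ := ((l : ℂ) + 2 * (n : ℂ) + 1)⁻¹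

open scoped InnerProductSpace

section BlockShift

variable {K : Type*} [NormedAddCommGroup K] [InnerProductSpace ℂ K]

/-- The orthogonal projection onto a reducing subspace of `T` commutes with `T`. -/
lemma starProjection_comm_of_reducing [CompleteSpace K] (T : K →L[ℂ] K) (M : Submodule ℂ K)
    [M.HasOrthogonalProjection] (hT : ∀ x ∈ M, T x ∈ M) (hT' : ∀ x ∈ M, adjoint T x ∈ M) (x : K) :
    M.starProjection (T x) = T (M.starProjection x) := by
  apply Submodule.eq_starProjection_of_mem_orthogonal (hT _ (M.starProjection_apply_mem x))
  rw [← map_sub, Submodule.mem_orthogonal]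
  intro u hu
  rw [← adjoint_inner_left]
  exact (Submodule.mem_orthogonal _ _).1 (M.sub_starProjection_mem_orthogonal x) _ (hT' u hu)

/-- If a symmetric operator `A` commutes with `P`, and `u`, `v` are annihilated by
`A ^ 2 - τ A + 1` and `A ^ 2 - σ A + 1` with `τ ≠ σ` real, then `P u` is orthogonal to `v`. -/
lemma inner_eq_zero_of_quadratic (A P : K →L[ℂ] K) (hA : ∀ x y, ⟪A x, y⟫_ℂ = ⟪x, A y⟫_ℂ)
    (hPA : ∀ x, P (A x) = A (P x)) {u v : K} {τ σ : ℝ} (hne : σ ≠ τ)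
    (hu : A (A u) = (τ : ℂ) • A u - u) (hv : A (A v) = (σ : ℂ) • A v - v) :
    ⟪v, P u⟫_ℂ = 0 := by
  have key : ∀ y : K, A (A y) = (τ : ℂ) • A y - y → ⟪v, P (A y)⟫_ℂ = 0 := by
    intro y hy
    have h₁ : ⟪v, P (A (A y))⟫_ℂ = ⟪A (A v), P y⟫_ℂ := by rw [hPA, hPA, hA, hA]
    have h₂ : ⟪v, P (A y)⟫_ℂ = ⟪A v, P y⟫_ℂ := by rw [hPA, hA]
    rw [hy, hv, map_sub, map_smul, inner_sub_left, inner_sub_right, inner_smul_left,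
      inner_smul_right, ← h₂, Complex.conj_ofReal] at h₁
    have h₃ : ((τ : ℂ) - σ) * ⟪v, P (A y)⟫_ℂ = 0 := by linear_combination h₁
    rcases mul_eq_zero.1 h₃ with h | h
    · exact absurd (by exact_mod_cast (sub_eq_zero.1 h).symm) hne
    · exact h
  have h₀ : A ((τ : ℂ) • u - A u) = u := by rw [map_sub, map_smul, hu]; abel
  have := key ((τ : ℂ) • u - A u) (by rw [h₀]; abel)
  rwa [h₀] at this

/-- An operator commuting with an upper triangular `2 × 2` block shift of determinant one and
its adjoint is a scalar, provided the blocks satisfy suitable genericity conditions. -/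
lemma exists_smul_of_comm_blockShift [CompleteSpace K] (f g : ℤ → K) (T P : K →L[ℂ] K)
    (w v s : ℤ → ℝ)
    (hff : ∀ m n, ⟪f m, f n⟫_ℂ = if m = n then 1 else 0)
    (hgg : ∀ m n, ⟪g m, g n⟫_ℂ = if m = n then 1 else 0)
    (hfg : ∀ m n, ⟪f m, g n⟫_ℂ = 0)
    (htot : ∀ x, (∀ n, ⟪f n, x⟫_ℂ = 0) → (∀ n, ⟪g n, x⟫_ℂ = 0) → x = 0)
    (hTf : ∀ n, T (f n) = (w n : ℂ) • f (n + 1))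
    (hTg : ∀ n, T (g n) = (s n : ℂ) • f (n + 1) + (v n : ℂ) • g (n + 1))
    (hwv : ∀ n, w n * v n = 1)
    (hs : s 1 ≠ 0)
    (hsep : ∀ m, m ≠ 1 → w m ^ 2 + s m ^ 2 + v m ^ 2 ≠ w 1 ^ 2 + s 1 ^ 2 + v 1 ^ 2 ∨
      w (m - 1) ^ 2 + s (m - 1) ^ 2 + v (m - 1) ^ 2 ≠ w 0 ^ 2 + s 0 ^ 2 + v 0 ^ 2)
    (hcomm : s 0 * v 0 * (w 1 ^ 2 - s 1 ^ 2 - v 1 ^ 2) ≠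
      s 1 * w 1 * (w 0 ^ 2 + s 0 ^ 2 - v 0 ^ 2))
    (hPT : ∀ x, P (T x) = T (P x)) (hPT' : ∀ x, P (adjoint T x) = adjoint T (P x)) :
    ∃ c : ℂ, ∀ n, P (f n) = c • f n ∧ P (g n) = c • g n := by
  have hgf : ∀ m n, ⟪g m, f n⟫_ℂ = 0 := fun m n => by
    rw [← inner_conj_symm, hfg, map_zero]
  have hext : ∀ x y, (∀ n, ⟪f n, x⟫_ℂ = ⟪f n, y⟫_ℂ) → (∀ n, ⟪g n, x⟫_ℂ = ⟪g n, y⟫_ℂ) → x = y :=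
    fun x y h₁ h₂ => sub_eq_zero.1 <| htot _
      (fun n => by rw [inner_sub_right, h₁, sub_self])
      (fun n => by rw [inner_sub_right, h₂, sub_self])
  have hwv' : ∀ n, (w n : ℂ) * v n = 1 := fun n => by exact_mod_cast hwv n
  have hTf' : ∀ n, adjoint T (f (n + 1)) = (w n : ℂ) • f n + (s n : ℂ) • g n := by
    intro n
    apply hext <;> intro m <;> rw [adjoint_inner_right] <;> by_cases h : m = n <;>
      simp only [hTf, hTg, inner_add_left, inner_add_right, inner_smul_left, inner_smul_right,
        hff, hgg, hfg, hgf, Complex.conj_ofReal, add_left_inj, h] <;>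
      simp
  have hTg' : ∀ n, adjoint T (g (n + 1)) = (v n : ℂ) • g n := by
    intro n
    apply hext <;> intro m <;> rw [adjoint_inner_right] <;> by_cases h : m = n <;>
      simp only [hTf, hTg, inner_add_left, inner_smul_left, inner_smul_right,
        hgg, hfg, Complex.conj_ofReal, add_left_inj, h] <;>
      simp
  set D : K →L[ℂ] K := adjoint T ∘L T with hD
  set E : K →L[ℂ] K := T ∘L adjoint T with hE
  have hDsym : ∀ x y, ⟪D x, y⟫_ℂ = ⟪x, D y⟫_ℂ := fun x y => by
    simp [hD, adjoint_inner_left, adjoint_inner_right]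
  have hEsym : ∀ x y, ⟪E x, y⟫_ℂ = ⟪x, E y⟫_ℂ := fun x y => by
    simp only [hE, comp_apply]
    rw [← adjoint_inner_right T, ← adjoint_inner_left T]
  have hPD : ∀ x, P (D x) = D (P x) := fun x => by simp [hD, hPT, hPT']
  have hPE : ∀ x, P (E x) = E (P x) := fun x => by simp [hE, hPT, hPT']
  have hDf : ∀ n, D (f n) = ((w n : ℂ) ^ 2) • f n + ((s n : ℂ) * w n) • g n := fun n => by
    simp only [hD, comp_apply, hTf, map_smul, hTf']; module
  have hDg : ∀ n, D (g n) = ((s n : ℂ) * w n) • f n + ((s n : ℂ) ^ 2 + (v n : ℂ) ^ 2) • g n :=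
    fun n => by simp only [hD, comp_apply, hTg, map_add, map_smul, hTf', hTg']; module
  have hEf : ∀ n, E (f (n + 1)) =
      ((w n : ℂ) ^ 2 + (s n : ℂ) ^ 2) • f (n + 1) + ((s n : ℂ) * v n) • g (n + 1) := fun n => by
    simp only [hE, comp_apply, hTf', map_add, map_smul, hTf, hTg]; module
  have hEg : ∀ n, E (g (n + 1)) =
      ((s n : ℂ) * v n) • f (n + 1) + ((v n : ℂ) ^ 2) • g (n + 1) := fun n => by
    simp only [hE, comp_apply, hTg', map_smul, hTg]; module
  have hDDf : ∀ n, D (D (f n)) =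
      ((w n ^ 2 + s n ^ 2 + v n ^ 2 : ℝ) : ℂ) • D (f n) - f n := fun n => by
    simp only [hDf, hDg, map_add, map_smul]
    push_cast
    match_scalars
    · linear_combination (-(w n : ℂ) * v n - 1) * hwv' n
    · ring
  have hDDg : ∀ n, D (D (g n)) =
      ((w n ^ 2 + s n ^ 2 + v n ^ 2 : ℝ) : ℂ) • D (g n) - g n := fun n => by
    simp only [hDf, hDg, map_add, map_smul]
    push_cast
    match_scalars
    · ring
    · linear_combination (-(w n : ℂ) * v n - 1) * hwv' n
  have hEEf : ∀ n, E (E (f (n + 1))) =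
      ((w n ^ 2 + s n ^ 2 + v n ^ 2 : ℝ) : ℂ) • E (f (n + 1)) - f (n + 1) := fun n => by
    simp only [hEf, hEg, map_add, map_smul]
    push_cast
    match_scalars
    · linear_combination (-(w n : ℂ) * v n - 1) * hwv' n
    · ring
  have hEEg : ∀ n, E (E (g (n + 1))) =
      ((w n ^ 2 + s n ^ 2 + v n ^ 2 : ℝ) : ℂ) • E (g (n + 1)) - g (n + 1) := fun n => by
    simp only [hEf, hEg, map_add, map_smul]
    push_cast
    match_scalars
    · ring
    · linear_combination (-(w n : ℂ) * v n - 1) * hwv' n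
  have hEEf' : ∀ n, E (E (f n)) =
      ((w (n - 1) ^ 2 + s (n - 1) ^ 2 + v (n - 1) ^ 2 : ℝ) : ℂ) • E (f n) - f n := fun n => by
    simpa using hEEf (n - 1)
  have hEEg' : ∀ n, E (E (g n)) =
      ((w (n - 1) ^ 2 + s (n - 1) ^ 2 + v (n - 1) ^ 2 : ℝ) : ℂ) • E (g n) - g n := fun n => by
    simpa using hEEg (n - 1)
  -- `P` maps the block with index one to itself
  have hblock : ∀ u, D (D u) = ((w 1 ^ 2 + s 1 ^ 2 + v 1 ^ 2 : ℝ) : ℂ) • D u - u →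
      E (E u) = ((w 0 ^ 2 + s 0 ^ 2 + v 0 ^ 2 : ℝ) : ℂ) • E u - u →
      P u = ⟪f 1, P u⟫_ℂ • f 1 + ⟪g 1, P u⟫_ℂ • g 1 := by
    intro u hDu hEu
    apply hext <;> intro m <;> by_cases hm : m = 1
    · subst hm; simp only [inner_add_right, inner_smul_right, hff, hfg, if_true, mul_one, mul_zero,
        add_zero]
    · rcases hsep m hm with h | h
      · rw [inner_eq_zero_of_quadratic D P hDsym hPD h hDu (hDDf m)]
        simp [hff, hfg, hm]
      · rw [inner_eq_zero_of_quadratic E P hEsym hPE h hEu (hEEf' m)]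
        simp [hff, hfg, hm]
    · subst hm; simp only [inner_add_right, inner_smul_right, hgg, hgf, if_true, mul_one, mul_zero,
        zero_add]
    · rcases hsep m hm with h | h
      · rw [inner_eq_zero_of_quadratic D P hDsym hPD h hDu (hDDg m)]
        simp [hgg, hgf, hm]
      · rw [inner_eq_zero_of_quadratic E P hEsym hPE h hEu (hEEg' m)]
        simp [hgg, hgf, hm]
  have hPf := hblock (f 1) (hDDf 1) (by simpa using hEEf' 1)
  have hPg := hblock (g 1) (hDDg 1) (by simpa using hEEg' 1)
  set p := ⟪f 1, P (f 1)⟫_ℂ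
  set q := ⟪g 1, P (f 1)⟫_ℂ
  set r := ⟪f 1, P (g 1)⟫_ℂ
  set t := ⟪g 1, P (g 1)⟫_ℂ
  have hEf1 : E (f 1) = ((w 0 : ℂ) ^ 2 + (s 0 : ℂ) ^ 2) • f 1 + ((s 0 : ℂ) * v 0) • g 1 := by
    simpa using hEf 0
  have hEg1 : E (g 1) = ((s 0 : ℂ) * v 0) • f 1 + ((v 0 : ℂ) ^ 2) • g 1 := by
    simpa using hEg 0
  have hDc := hPD (f 1)
  rw [hPf, hDf] at hDc
  simp only [map_add, map_smul, hPf, hPg, hDf, hDg] at hDc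
  have hEc := hPE (f 1)
  rw [hPf, hEf1] at hEc
  simp only [map_add, map_smul, hPf, hPg, hEf1, hEg1] at hEc
  have hD₁ := congrArg (fun x => ⟪f 1, x⟫_ℂ) hDc
  have hD₂ := congrArg (fun x => ⟪g 1, x⟫_ℂ) hDc
  have hE₂ := congrArg (fun x => ⟪g 1, x⟫_ℂ) hEc
  simp only [inner_add_right, inner_smul_right, hff, hgg, hfg, hgf, if_true] at hD₁ hD₂ hE₂
  have hs' : (s 1 : ℂ) * w 1 ≠ 0 := by
    have := left_ne_zero_of_mul_eq_one (hwv 1)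
    exact_mod_cast mul_ne_zero hs this
  have hrq : r = q := mul_left_cancel₀ hs' (by linear_combination hD₁)
  have hq : q = 0 := by
    have hc : ((s 0 : ℂ) * v 0 * (w 1 ^ 2 - s 1 ^ 2 - v 1 ^ 2) -
        s 1 * w 1 * (w 0 ^ 2 + s 0 ^ 2 - v 0 ^ 2)) ≠ 0 := by
      rw [sub_ne_zero]; exact_mod_cast hcomm
    refine (mul_eq_zero.1 ?_).resolve_left hc
    linear_combination (s 0 : ℂ) * v 0 * hD₂ - (s 1 : ℂ) * w 1 * hE₂
  have hpt : t = p := mul_left_cancel₀ hs' (by rw [hq] at hD₂; linear_combination hD₂)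
  rw [hq, zero_smul, add_zero] at hPf
  rw [hrq, hq, hpt, zero_smul, zero_add] at hPg
  refine ⟨p, fun n => ?_⟩
  induction n using Int.inductionOn' (b := 1) with
  | zero => exact ⟨hPf, hPg⟩
  | succ k _ ih =>
    have hf : f (k + 1) = (v k : ℂ) • T (f k) := by
      rw [hTf, smul_smul, mul_comm, hwv', one_smul]
    have hPf' : P (f (k + 1)) = p • f (k + 1) := by
      rw [hf, map_smul, hPT, ih.1, map_smul, smul_comm]
    have hg : g (k + 1) = (w k : ℂ) • (T (g k) - (s k : ℂ) • f (k + 1)) := by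
      rw [hTg, add_sub_cancel_left, smul_smul, hwv', one_smul]
    refine ⟨hPf', ?_⟩
    rw [hg, map_smul, map_sub, hPT, ih.2, map_smul, map_smul, hPf']
    module
  | pred k _ ih =>
    have hg : g (k - 1) = (w (k - 1) : ℂ) • adjoint T (g k) := by
      have := hTg' (k - 1)
      rw [sub_add_cancel] at this
      rw [this, smul_smul, hwv', one_smul]
    have hPg' : P (g (k - 1)) = p • g (k - 1) := by
      rw [hg, map_smul, hPT', ih.2, map_smul, smul_comm]
    have hf : f (k - 1) = (v (k - 1) : ℂ) • (adjoint T (f k) - (s (k - 1) : ℂ) • g (k - 1)) := by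
      have := hTf' (k - 1)
      rw [sub_add_cancel] at this
      rw [this, add_sub_cancel_right, smul_smul, mul_comm, hwv', one_smul]
    refine ⟨?_, hPg'⟩
    rw [hf, map_smul, map_sub, hPT', ih.1, map_smul, map_smul, hPg']
    module

end BlockShift

lemma inner_e_left (n : ℤ) (x : H) : ⟪e n, x⟫_ℂ = x n := by
  simp [e, lp.inner_single_left]

lemma e_apply (m n : ℤ) : (e n : H) m = if m = n then 1 else 0 := by
  simp [e, Pi.single_apply]

lemma blockOp_toLp {E : Type*} [NormedAddCommGroup E] [NormedSpace ℂ E]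
    (T₁ S T₂ : E →L[ℂ] E) (x y : E) :
    blockOp T₁ S T₂ (WithLp.toLp 2 (x, y)) = WithLp.toLp 2 (T₁ x + S y, T₂ y) := rfl

lemma intCast_add_ne_zero {a : ℝ} (ha : 0 < a) (ha' : a < 1) (n : ℤ) : (n : ℝ) + a ≠ 0 := by
  intro h
  have h₁ : (-1 : ℝ) < n := by linarith
  have h₂ : (n : ℝ) < 0 := by linarith
  have h₃ : -1 < n := by exact_mod_cast h₁
  have h₄ : n < 0 := by exact_mod_cast h₂
  omega

lemma intCast_add_div_pos {a b : ℝ} (ha : 0 < a) (ha' : a < 1) (hb : 0 < b) (hb' : b < 1) (n : ℤ) :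
    0 < ((n : ℝ) + a) / (n + b) := by
  rcases le_or_gt 0 n with h | h
  · have : (0 : ℝ) ≤ n := by exact_mod_cast h
    positivity
  · have : (n : ℝ) ≤ -1 := by exact_mod_cast (by omega : n ≤ -1)
    exact div_pos_of_neg_of_neg (by linarith) (by linarith)

/-- the operator `T(a, b, α)` is irreducible. -/
theorem stmt9 (a b α : ℝ) (ha : 0 < a) (hab : a < b) (hb : b < 1) (hα : 0 < α)
    (T₁ T₂ : H →L[ℂ] H)
    (hT₁ : ∀ n : ℤ, T₁ (e n) = wT a b n • e (n + 1))
    (hT₂ : ∀ n : ℤ, T₂ (e n) = wT b a n • e (n + 1)) :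
    IrreducibleOp (blockOp T₁ ((α : ℂ) • (T₁ - T₂)) T₂) := by
  have hb₀ : 0 < b := ha.trans hab
  have ha₁ : a < 1 := hab.trans hb
  intro M hMc hMT hMT'
  have : CompleteSpace M := hMc.completeSpace_coe
  set T := blockOp T₁ ((α : ℂ) • (T₁ - T₂)) T₂ with hT
  set w : ℤ → ℝ := fun n => √(((n : ℝ) + a) / (n + b)) with hw
  set v : ℤ → ℝ := fun n => √(((n : ℝ) + b) / (n + a)) with hv
  set f : ℤ → WithLp 2 (H × H) := fun n => WithLp.toLp 2 (e n, 0) with hf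
  set g : ℤ → WithLp 2 (H × H) := fun n => WithLp.toLp 2 (0, e n) with hg
  have hna : ∀ n : ℤ, (n : ℝ) + a ≠ 0 := intCast_add_ne_zero ha ha₁
  have hnb : ∀ n : ℤ, (n : ℝ) + b ≠ 0 := intCast_add_ne_zero hb₀ hb
  have hw2 : ∀ n, w n ^ 2 = ((n : ℝ) + a) / (n + b) := fun n =>
    Real.sq_sqrt (intCast_add_div_pos ha ha₁ hb₀ hb n).le
  have hv2 : ∀ n, v n ^ 2 = ((n : ℝ) + b) / (n + a) := fun n =>
    Real.sq_sqrt (intCast_add_div_pos hb₀ hb ha ha₁ n).le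
  have hwv : ∀ n, w n * v n = 1 := fun n => by
    simp only [hw, hv]
    rw [← Real.sqrt_mul (intCast_add_div_pos ha ha₁ hb₀ hb n).le, div_mul_div_comm,
      mul_comm ((n : ℝ) + b), div_self (mul_ne_zero (hna n) (hnb n)), Real.sqrt_one]
  have hτ : ∀ n, w n ^ 2 + (α * (w n - v n)) ^ 2 + v n ^ 2 =
      2 + (1 + α ^ 2) * (b - a) ^ 2 / ((n + a) * (n + b)) := fun n => by
    have h : (w n - v n) ^ 2 = (b - a) ^ 2 / ((n + a) * (n + b)) := by
      have : (w n - v n) ^ 2 = w n ^ 2 + v n ^ 2 - 2 := by linear_combination (-2) * hwv n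
      rw [this, hw2, hv2]
      field_simp [hna n, hnb n]
      ring
    rw [mul_div_assoc, ← h]
    linear_combination 2 * hwv n
  have hαpos : 0 < 1 + α ^ 2 := by positivity
  have hba : 0 < b - a := sub_pos.2 hab
  have hτinj : ∀ m n : ℤ, w m ^ 2 + (α * (w m - v m)) ^ 2 + v m ^ 2 =
      w n ^ 2 + (α * (w n - v n)) ^ 2 + v n ^ 2 → m = n ∨ (m : ℝ) + n = -(a + b) := by
    intro m n h
    rw [hτ, hτ, add_right_inj, div_eq_div_iff (mul_ne_zero (hna m) (hnb m))
      (mul_ne_zero (hna n) (hnb n))] at h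
    have h₁ := mul_left_cancel₀ (by positivity : (1 + α ^ 2) * (b - a) ^ 2 ≠ 0) h
    have h₂ : ((m : ℝ) - n) * (m + n + (a + b)) = 0 := by linear_combination -h₁
    rcases mul_eq_zero.1 h₂ with h | h
    · left; exact_mod_cast sub_eq_zero.1 h
    · right; linarith
  have hwvne : ∀ n, w n ^ 2 - 1 ≠ 0 := fun n h => by
    rw [hw2, sub_eq_zero, div_eq_one_iff_eq (hnb n)] at h
    linarith
  have hw0 : ∀ n, w n ≠ 0 := fun n => left_ne_zero_of_mul_eq_one (hwv n)
  have hvw : ∀ n, v n = (w n)⁻¹ := fun n => (inv_eq_of_mul_eq_one_right (hwv n)).symm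
  have hPT := starProjection_comm_of_reducing T M hMT hMT'
  have hPT' := starProjection_comm_of_reducing (adjoint T) M hMT' (by simpa using hMT)
  obtain ⟨c, hc⟩ := exists_smul_of_comm_blockShift f g T M.starProjection w v
    (fun n => α * (w n - v n))
    (fun m n => by simp [hf, WithLp.prod_inner_apply, inner_e_left, e_apply])
    (fun m n => by simp [hg, WithLp.prod_inner_apply, inner_e_left, e_apply])
    (fun m n => by simp [hf, hg, WithLp.prod_inner_apply])
    (fun x h₁ h₂ => by
      simp only [hf, hg, WithLp.prod_inner_apply, inner_zero_left, add_zero, zero_add,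
        inner_e_left] at h₁ h₂
      apply (WithLp.equiv 2 (H × H)).injective
      exact Prod.ext (lp.ext (funext h₁)) (lp.ext (funext h₂)))
    (fun n => by
      simp only [hf, hT, blockOp_toLp, map_zero, add_zero, hT₁]
      rw [← WithLp.toLp_smul, Prod.smul_mk, smul_zero]
      rfl)
    (fun n => by
      simp only [hf, hg, hT, blockOp_toLp, map_zero, zero_add, smul_apply, sub_apply, hT₁, hT₂]
      rw [← WithLp.toLp_smul, ← WithLp.toLp_smul, ← WithLp.toLp_add, Prod.smul_mk, Prod.smul_mk,
        Prod.mk_add_mk, smul_zero, smul_zero, add_zero, zero_add, ← sub_smul, smul_smul]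
      simp [wT, hw, hv])
    hwv
    (by
      refine mul_ne_zero hα.ne' fun h => hwvne 1 ?_
      linear_combination w 1 * h + hwv 1)
    (fun m hm => by
      by_contra! h
      obtain ⟨h₁, h₂⟩ := h
      have h₁ := (hτinj _ _ h₁).resolve_left hm
      have h₂ := (hτinj _ _ h₂).resolve_left (by omega)
      push_cast at h₁ h₂
      linarith)
    (by
      intro h
      have h0 := hwvne 0
      have h1 := hwvne 1
      have e0 := hw0 0
      have e1 := hw0 1
      rw [hvw, hvw] at h
      have key : α * (1 + α ^ 2) * (w 0 ^ 2 - 1) * (w 1 ^ 2 - 1) *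
          (w 0 ^ 2 * w 1 ^ 2 - 1) = 0 := by
        rw [← sub_eq_zero] at h
        rw [← neg_eq_zero, ← mul_zero (w 0 ^ 2 * w 1 ^ 2), ← h]
        field_simp
        ring
      have key₂ : w 0 ^ 2 * w 1 ^ 2 - 1 = 0 := by
        refine (mul_eq_zero.1 key).resolve_left ?_
        have := hα.ne'
        have := hαpos.ne'
        positivity
      rw [hw2, hw2, sub_eq_zero] at key₂
      push_cast at key₂
      rw [div_mul_div_comm, div_eq_one_iff_eq (by positivity)] at key₂
      nlinarith)
    hPT hPT'
  have hP : ∀ x, M.starProjection x = (starRingEnd ℂ c) • x := by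
    intro x
    apply (WithLp.equiv 2 (H × H)).injective
    refine Prod.ext (lp.ext (funext fun n => ?_)) (lp.ext (funext fun n => ?_))
    · have := M.inner_starProjection_left_eq_right (f n) x
      rw [(hc n).1, inner_smul_left] at this
      simpa [hf, WithLp.prod_inner_apply, inner_e_left] using this.symm
    · have := M.inner_starProjection_left_eq_right (g n) x
      rw [(hc n).2, inner_smul_left] at this
      simpa [hg, WithLp.prod_inner_apply, inner_e_left] using this.symm
  by_cases h : (starRingEnd ℂ) c = 0
  · left
    refine (Submodule.eq_bot_iff _).2 fun x hx => ?_
    rw [← Submodule.starProjection_eq_self_iff.2 hx, hP, h, zero_smul]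
  · right
    refine (Submodule.eq_top_iff').2 fun x => ?_
    rw [← inv_smul_smul₀ h x, ← hP]
    exact M.smul_mem _ (M.starProjection_apply_mem x)
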